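/- Let X be a metrizable space that is a Souslin-F set in some completely metrizable space Z containing it (i.e., X is an absolute Souslin-F set), and let Y be a regular topological space. Then a mapping f : X → Y is Δ⁰₂-measurable if and only if it is piecewise continuous. -/

import Mathlib

open Set Topology

/-- A set is Fσ if it is a countable union of closed sets. -/
def IsFsigma {X : Type*} [TopologicalSpace X] (s : Set X) : Prop :=
  ∃ C : ℕ → Set X, (∀ n, IsClosed (C n)) ∧ s = ⋃ n, C n

/-- A map is piecewise continuous if its domain is covered by countably many
closed sets on each of which the map is continuous. -/
def PiecewiseContinuous {X Y : Type*} [TopologicalSpace X] [TopologicalSpace Y]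
    (f : X → Y) : Prop :=
  ∃ C : ℕ → Set X, (∀ n, IsClosed (C n)) ∧ (⋃ n, C n) = Set.univ ∧
    ∀ n, ContinuousOn f (C n)

/-- A map is Δ⁰₂-measurable if preimages of open sets are both Fσ and Gδ. -/
def Delta02Measurable {X Y : Type*} [TopologicalSpace X] [TopologicalSpace Y]
    (f : X → Y) : Prop :=
  ∀ U : Set Y, IsOpen U → IsFsigma (f ⁻¹' U) ∧ IsGδ (f ⁻¹' U)

/-- A map is Σ⁰₂-measurable if preimages of open sets are Fσ. -/
def Sigma02Measurable {X Y : Type*} [TopologicalSpace X] [TopologicalSpace Y]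
    (f : X → Y) : Prop :=
  ∀ U : Set Y, IsOpen U → IsFsigma (f ⁻¹' U)

/-- X ⊆ Z is Souslin-F in Z: the result of the A-operation applied to a system
of closed subsets of Z, where `(List.range n).map α` encodes α|n. -/
def SouslinF {Z : Type*} [TopologicalSpace Z] (X : Set Z) : Prop :=
  ∃ F : List ℕ → Set Z, (∀ s, IsClosed (F s)) ∧
    X = ⋃ α : ℕ → ℕ, ⋂ n : ℕ, F ((List.range n).map α)

/-- A space is completely Baire if every closed subspace is a Baire space. -/
def CompletelyBaire (Z : Type*) [TopologicalSpace Z] : Prop :=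
  ∀ s : Set Z, IsClosed s → BaireSpace s

/-- Membership in the σ-ideal I_f: A is contained in an Fσ set F such that
the restriction f|F is piecewise continuous. -/
def MemIf {X Y : Type*} [TopologicalSpace X] [TopologicalSpace Y]
    (f : X → Y) (A : Set X) : Prop :=
  ∃ F : Set X, IsFsigma F ∧ A ⊆ F ∧ PiecewiseContinuous (F.restrict f)

/-- A^f = f⁻¹(Y \ cl(A)). -/
def Af {X Y : Type*} [TopologicalSpace Y] (f : X → Y) (A : Set Y) : Set X :=
  f ⁻¹' (closure A)ᶜ

/-- The pair (x, X′) is f-irreducible outside A: for every open neighborhood V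
of x, A^f ∩ X′ ∩ V ∉ I_f. -/
def IrredOutside {X Y : Type*} [TopologicalSpace X] [TopologicalSpace Y]
    (f : X → Y) (x : X) (X' : Set X) (A : Set Y) : Prop :=
  ∀ V : Set X, IsOpen V → x ∈ V → ¬ MemIf f (Af f A ∩ X' ∩ V)

/-- The σ-ideal `I_f` consists of the sets covered by countably many closed sets on each of which
`f` is continuous. -/
theorem memIf_iff {X Y : Type*} [TopologicalSpace X] [TopologicalSpace Y] {f : X → Y}
    {A : Set X} :
    MemIf f A ↔ ∃ C : ℕ → Set X, (∀ n, IsClosed (C n)) ∧ A ⊆ (⋃ n, C n) ∧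
      ∀ n, ContinuousOn f (C n) := by
  constructor
  · rintro ⟨F, ⟨D, hD, rfl⟩, hA, E, hE, hEu, hEc⟩
    refine ⟨fun n => D n.unpair.1 ∩ closure (Subtype.val '' E n.unpair.2),
      fun n => (hD _).inter isClosed_closure, fun x hx => ?_, fun n x hx => ?_⟩
    · obtain ⟨i, hi⟩ := mem_iUnion.1 (hA hx)
      have hx' : (⟨x, hA hx⟩ : ↥(⋃ n, D n)) ∈ ⋃ n, E n := hEu ▸ mem_univ _
      obtain ⟨j, hj⟩ := mem_iUnion.1 hx'
      refine mem_iUnion.2 ⟨Nat.pair i j, ?_⟩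
      simp only [Nat.unpair_pair]
      exact ⟨hi, subset_closure ⟨_, hj, rfl⟩⟩
    · have key : ∀ y, y ∈ D n.unpair.1 ∩ closure (Subtype.val '' E n.unpair.2) →
          y ∈ Subtype.val '' E n.unpair.2 := by
        rintro y ⟨hy, hyc⟩
        refine ⟨⟨y, mem_iUnion.2 ⟨_, hy⟩⟩, ?_, rfl⟩
        rw [← (hE n.unpair.2).closure_eq,
          Topology.IsInducing.subtypeVal.closure_eq_preimage_closure_image]
        exact hyc
      obtain ⟨y, hy, rfl⟩ := key x hx
      have h1 := hEc n.unpair.2 y hy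
      have h2 : ContinuousWithinAt f (Subtype.val '' E n.unpair.2) y := by
        rw [ContinuousWithinAt, ← Topology.IsInducing.subtypeVal.map_nhdsWithin_eq]
        exact h1
      exact h2.mono key
  · rintro ⟨C, hC, hA, hc⟩
    refine ⟨⋃ n, C n, ⟨C, hC, rfl⟩, hA, fun n => Subtype.val ⁻¹' C n,
      fun n => (hC n).preimage continuous_subtype_val, ?_, fun n => ?_⟩
    · rw [← preimage_iUnion, Subtype.coe_preimage_self]
    · exact (hc n).comp continuous_subtype_val.continuousOn fun x hx => hx

theorem Af_anti {X Y : Type*} [TopologicalSpace Y] {f : X → Y} {A B : Set Y} (h : A ⊆ B) :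
    Af f B ⊆ Af f A :=
  preimage_mono (compl_subset_compl.2 (closure_mono h))

section Ideal

variable {X Y : Type*} [TopologicalSpace X] [TopologicalSpace Y] {f : X → Y}

theorem MemIf.mono {A B : Set X} (hB : MemIf f B) (h : A ⊆ B) : MemIf f A :=
  let ⟨F, hF, hBF, hc⟩ := hB
  ⟨F, hF, h.trans hBF, hc⟩

theorem IsClosed.memIf {C : Set X} (hC : IsClosed C) (hf : ContinuousOn f C) : MemIf f C :=
  memIf_iff.2 ⟨fun _ => C, fun _ => hC, fun _ hx => mem_iUnion.2 ⟨0, hx⟩, fun _ => hf⟩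

theorem MemIf.iUnion {A : ℕ → Set X} (h : ∀ n, MemIf f (A n)) : MemIf f (⋃ n, A n) := by
  simp only [memIf_iff] at h
  choose C hC hA hc using h
  refine memIf_iff.2 ⟨fun n => C n.unpair.1 n.unpair.2, fun n => hC _ _, fun x hx => ?_,
    fun n => hc _ _⟩
  obtain ⟨i, hi⟩ := mem_iUnion.1 hx
  obtain ⟨j, hj⟩ := mem_iUnion.1 (hA i hi)
  exact mem_iUnion.2 ⟨Nat.pair i j, by simpa using hj⟩

theorem MemIf.union {A B : Set X} (hA : MemIf f A) (hB : MemIf f B) : MemIf f (A ∪ B) := by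
  refine (MemIf.iUnion (A := fun n => if n = 0 then A else B) fun n => ?_).mono ?_
  · split_ifs
    exacts [hA, hB]
  · rintro x (hx | hx)
    · exact mem_iUnion.2 ⟨0, by simpa using hx⟩
    · exact mem_iUnion.2 ⟨1, by simpa using hx⟩

theorem IrredOutside.anti {x : X} {T : Set X} {A B : Set Y} (h : IrredOutside f x T B)
    (hAB : A ⊆ B) : IrredOutside f x T A := fun V hV hx hm =>
  h V hV hx (hm.mono (inter_subset_inter_left _ (inter_subset_inter_left _ (Af_anti hAB))))

/-- If two sets have disjoint closures, irreducibility survives the addition of one of them. -/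
theorem IrredOutside.union_or_union {x : X} {T : Set X} {A B C : Set Y}
    (h : IrredOutside f x T A) (hBC : Disjoint (closure B) (closure C)) :
    IrredOutside f x T (A ∪ B) ∨ IrredOutside f x T (A ∪ C) := by
  by_contra! hcon
  simp only [IrredOutside, not_forall, not_not] at hcon
  obtain ⟨⟨V, hV, hxV, hmV⟩, W, hW, hxW, hmW⟩ := hcon
  refine h (V ∩ W) (hV.inter hW) ⟨hxV, hxW⟩ ((hmV.union hmW).mono ?_)
  rintro y ⟨⟨hyA, hyT⟩, hyV, hyW⟩
  by_cases hy : f y ∈ closure B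
  · refine Or.inr ⟨⟨?_, hyT⟩, hyW⟩
    simp only [Af, closure_union, mem_preimage, mem_compl_iff, mem_union, not_or] at hyA ⊢
    exact ⟨hyA, disjoint_left.1 hBC hy⟩
  · refine Or.inl ⟨⟨?_, hyT⟩, hyV⟩
    simp only [Af, closure_union, mem_preimage, mem_compl_iff, mem_union, not_or] at hyA ⊢
    exact ⟨hyA, hy⟩

end Ideal

section Metric

variable {X Y : Type*} [PseudoMetricSpace X] [TopologicalSpace Y] {f : X → Y}

/-- A set which is locally in `I_f` is in `I_f`. -/
theorem memIf_of_locally {A : Set X} (h : ∀ x ∈ A, ∃ V, IsOpen V ∧ x ∈ V ∧ MemIf f (A ∩ V)) :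
    MemIf f A := by
  have h' : ∀ x : A, ∃ V, IsOpen V ∧ x.1 ∈ V ∧ ∃ C : ℕ → Set X, (∀ n, IsClosed (C n)) ∧
      A ∩ V ⊆ (⋃ n, C n) ∧ ∀ n, ContinuousOn f (C n) := fun x => by
    simpa only [memIf_iff] using h x x.2
  choose V hV hxV C hC hAC hc using h'
  let E : ℕ → A → Set X := fun n i =>
    {x | ∀ y ∉ V i, 1 / ((n : ℝ) + 1) ≤ dist x y} ∩
      {x | ∀ j, WellOrderingRel j i → x ∉ V j}
  have hE : ∀ n i, IsClosed (E n i) := fun n i => by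
    refine IsClosed.inter ?_ ?_
    · simp only [ofPred_forall]
      exact isClosed_iInter fun y => isClosed_iInter fun _ =>
        isClosed_le continuous_const (continuous_id.dist continuous_const)
    · simp only [ofPred_forall]
      exact isClosed_iInter fun j => isClosed_iInter fun _ => (hV j).isClosed_compl
  have hsep : ∀ n i j x y, x ∈ E n i → y ∈ E n j → dist x y < 1 / ((n : ℝ) + 1) → i = j := by
    intro n i j x y hx hy hxy
    rcases trichotomous_of WellOrderingRel i j with hij | hij | hij
    · exact absurd (hx.1 y (hy.2 i hij)) (not_le.2 hxy)
    · exact hij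
    · exact absurd (hy.1 x (hx.2 j hij)) (not_le.2 (dist_comm x y ▸ hxy))
  have hfin : ∀ n m, LocallyFinite fun i => E n i ∩ C i m := by
    intro n m x
    have hn : (0 : ℝ) < 1 / ((n : ℝ) + 1) / 2 := by positivity
    refine ⟨Metric.ball x (1 / ((n : ℝ) + 1) / 2), Metric.ball_mem_nhds x hn,
      Set.Subsingleton.finite ?_⟩
    rintro i ⟨y, ⟨hy, -⟩, hyx⟩ j ⟨z, ⟨hz, -⟩, hzx⟩
    refine hsep n i j y z hy hz ?_
    have := dist_triangle_right y z x
    rw [Metric.mem_ball] at hyx hzx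
    linarith
  refine (MemIf.iUnion fun n => MemIf.iUnion fun m => IsClosed.memIf
    ((hfin n m).isClosed_iUnion fun i => (hE n i).inter (hC i m))
    ((hfin n m).continuousOn_iUnion (fun i => (hE n i).inter (hC i m))
      fun i => (hc i m).mono inter_subset_right)).mono fun x hx => ?_
  obtain ⟨i, hi, hmin⟩ := (IsWellFounded.wf (r := (WellOrderingRel : A → A → Prop))).has_min
    {i | x ∈ V i} ⟨⟨x, hx⟩, hxV _⟩
  obtain ⟨ε, hε, hball⟩ := Metric.isOpen_iff.1 (hV i) x hi
  obtain ⟨n, hn⟩ := exists_nat_one_div_lt hε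
  obtain ⟨m, hm⟩ := mem_iUnion.1 (hAC i ⟨hx, hi⟩)
  refine mem_iUnion.2 ⟨n, mem_iUnion.2 ⟨m, mem_iUnion.2 ⟨i, ⟨fun y hy => ?_, fun j hj hxj =>
    hmin j hxj hj⟩, hm⟩⟩⟩
  by_contra! hlt
  exact hy (hball (by rw [Metric.mem_ball, dist_comm]; linarith))

variable [RegularSpace Y]

theorem exists_irredOutside {T : Set X} (hT : ¬ MemIf f T) :
    ∃ x ∈ closure T, ∃ U, IsOpen U ∧ f x ∈ U ∧ IrredOutside f x T U := by
  by_contra! hcon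
  let L : Set X := {x | ∃ V, IsOpen V ∧ x ∈ V ∧ MemIf f (T ∩ V)}
  have hL : MemIf f (T ∩ L) := memIf_of_locally fun x ⟨_, V, hV, hxV, hm⟩ =>
    ⟨V, hV, hxV, hm.mono (inter_subset_inter_left _ inter_subset_left)⟩
  have hD : ∀ x ∈ closure (T \ L), ∀ V, IsOpen V → x ∈ V → ¬ MemIf f (T ∩ V) := by
    intro x hx V hV hxV hm
    obtain ⟨y, hyV, -, hyL⟩ := mem_closure_iff.1 hx V hV hxV
    exact hyL ⟨V, hV, hyV, hm⟩
  have hc : ContinuousOn f (closure (T \ L)) := by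
    intro x hx
    refine (closed_nhds_basis (f x)).tendsto_right_iff.2 fun K ⟨hK, hKc⟩ => ?_
    have hxT : x ∈ closure T := closure_mono sdiff_subset hx
    have h1 := hcon x hxT (interior K) isOpen_interior (mem_interior_iff_mem_nhds.2 hK)
    simp only [IrredOutside, not_forall, not_not] at h1
    obtain ⟨V, hV, hxV, hm⟩ := h1
    filter_upwards [mem_nhdsWithin_of_mem_nhds (hV.mem_nhds hxV), self_mem_nhdsWithin]
      with y hyV hyD
    by_contra hyK
    obtain ⟨K', ⟨hK', hKc'⟩, hKK'⟩ :=
      (closed_nhds_basis (f y)).mem_iff.1 (hKc.isOpen_compl.mem_nhds hyK)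
    have h2 := hcon y (closure_mono sdiff_subset hyD) (interior K') isOpen_interior
      (mem_interior_iff_mem_nhds.2 hK')
    simp only [IrredOutside, not_forall, not_not] at h2
    obtain ⟨V', hV', hyV', hm'⟩ := h2
    refine hD y hyD (V ∩ V') (hV.inter hV') ⟨hyV, hyV'⟩ ((hm.union hm').mono ?_)
    rintro z ⟨hzT, hzV, hzV'⟩
    by_cases hz : f z ∈ K
    · exact Or.inr ⟨⟨fun h => hKK' (closure_minimal interior_subset hKc' h) hz, hzT⟩, hzV'⟩
    · exact Or.inl ⟨⟨fun h => hz (closure_minimal interior_subset hKc h), hzT⟩, hzV⟩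
  refine hT ((hL.union (isClosed_closure.memIf hc)).mono fun x hx => ?_)
  by_cases hxL : x ∈ L
  · exact Or.inl ⟨hx, hxL⟩
  · exact Or.inr (subset_closure ⟨hx, hxL⟩)

/-- A new irreducible point can be found inside a set outside of `I_f`, without destroying the
irreducibility of finitely many given points. -/
theorem Sigma02Measurable.exists_irredOutside (hf : Sigma02Measurable f) {ι : Type*}
    (I : Finset ι) {x : ι → X} {T : ι → Set X} {A : Set Y}
    (hI : ∀ i ∈ I, IrredOutside f (x i) (T i) A) {S : Set X} (hS : ¬ MemIf f S) {W : Set Y}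
    (hW : IsOpen W) (hSW : S ⊆ f ⁻¹' W) :
    ∃ x' T' U, T' ⊆ S ∧ closure T' ⊆ f ⁻¹' W ∧ x' ∈ closure T' ∧ IsOpen U ∧ f x' ∈ U ∧
      closure U ⊆ W ∧ IrredOutside f x' T' U ∧
      ∀ i ∈ I, IrredOutside f (x i) (T i) (A ∪ U) := by
  classical
  induction I using Finset.induction_on generalizing S W with
  | empty =>
    obtain ⟨C, hC, hWC⟩ := hf W hW
    have : ∃ n, ¬ MemIf f (S ∩ C n) := by
      by_contra! h
      refine hS ((MemIf.iUnion h).mono ?_)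
      rw [← inter_iUnion, ← hWC]
      exact subset_inter Subset.rfl hSW
    obtain ⟨n, hn⟩ := this
    obtain ⟨x', hx', U, hU, hxU, hirr⟩ := _root_.exists_irredOutside hn
    have hcl : closure (S ∩ C n) ⊆ f ⁻¹' W :=
      (closure_minimal inter_subset_right (hC n)).trans (hWC ▸ subset_iUnion C n)
    obtain ⟨K, ⟨hK, hKc⟩, hKW⟩ :=
      (closed_nhds_basis (f x')).mem_iff.1 ((hU.inter hW).mem_nhds ⟨hxU, hcl hx'⟩)
    have hKU : interior K ⊆ U := interior_subset.trans (hKW.trans inter_subset_left)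
    exact ⟨x', S ∩ C n, interior K, inter_subset_left, hcl, hx', isOpen_interior,
      mem_interior_iff_mem_nhds.2 hK,
      (closure_minimal interior_subset hKc).trans (hKW.trans inter_subset_right),
      hirr.anti hKU, by simp⟩
  | insert j I _ ih =>
    have hI' : ∀ i ∈ I, IrredOutside f (x i) (T i) A := fun i hi =>
      hI i (Finset.mem_insert_of_mem hi)
    obtain ⟨x₁, T₁, U₁, hT₁, hcl₁, hx₁, hU₁, hxU₁, hUW₁, hirr₁, hI₁⟩ := ih hI' hS hW hSW
    by_cases hj : IrredOutside f (x j) (T j) (A ∪ U₁)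
    · exact ⟨x₁, T₁, U₁, hT₁, hcl₁, hx₁, hU₁, hxU₁, hUW₁, hirr₁,
        Finset.forall_mem_insert _ _ _ |>.2 ⟨hj, hI₁⟩⟩
    · obtain ⟨x₂, T₂, U₂, hT₂, hcl₂, hx₂, hU₂, hxU₂, hUW₂, hirr₂, hI₂⟩ :=
        ih hI' (hirr₁ univ isOpen_univ (mem_univ _)) (hW.inter isClosed_closure.isOpen_compl)
          fun y hy => ⟨hSW (hT₁ hy.1.2), hy.1.1⟩
      refine ⟨x₂, T₂, U₂, fun y hy => hT₁ (hT₂ hy).1.2, fun y hy => (hcl₂ hy).1, hx₂, hU₂, hxU₂,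
        fun y hy => (hUW₂ hy).1, hirr₂, Finset.forall_mem_insert _ _ _ |>.2 ⟨?_, hI₂⟩⟩
      exact ((hI j (Finset.mem_insert_self j I)).union_or_union
        (disjoint_right.2 fun y hy => (hUW₂ hy).2)).resolve_left hj

end Metric

theorem PiecewiseContinuous.delta02Measurable {X Y : Type*} [PseudoMetricSpace X]
    [TopologicalSpace Y] {f : X → Y} (hf : PiecewiseContinuous f) : Delta02Measurable f := by
  obtain ⟨C, hC, hCu, hc⟩ := hf
  have hcover : ∀ x, ∃ n, x ∈ C n := fun x => mem_iUnion.1 (hCu ▸ mem_univ x)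
  intro U hU
  constructor
  · choose V hV hVC using fun n => continuousOn_iff'.1 (hc n) U hU
    choose D hD _ hDV _ using fun n => (hV n).exists_iUnion_isClosed
    refine ⟨fun n => D n.unpair.1 n.unpair.2 ∩ C n.unpair.1, fun n => (hD _ _).inter (hC _), ?_⟩
    ext x
    have hx : ∀ n, x ∈ C n → (x ∈ f ⁻¹' U ↔ x ∈ V n) := fun n hn => by
      have := congrArg (x ∈ ·) (hVC n)
      simpa [hn] using this
    constructor
    · intro hxU
      obtain ⟨n, hn⟩ := hcover x
      have hxV := (hx n hn).1 hxU
      rw [← hDV n] at hxV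
      obtain ⟨m, hm⟩ := mem_iUnion.1 hxV
      exact mem_iUnion.2 ⟨Nat.pair n m, by simpa using ⟨hm, hn⟩⟩
    · intro h
      obtain ⟨n, hn, hnC⟩ := mem_iUnion.1 h
      exact (hx _ hnC).2 (hDV n.unpair.1 ▸ mem_iUnion.2 ⟨_, hn⟩)
  · have heq : f ⁻¹' U = ⋂ n, (C n ∩ f ⁻¹' Uᶜ)ᶜ := by
      ext x
      simp only [mem_iInter, mem_compl_iff, mem_inter_iff, mem_preimage, not_and, not_not]
      obtain ⟨n, hn⟩ := hcover x
      exact ⟨fun h _ _ => h, fun h => h n hn⟩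
    rw [heq]
    exact IsGδ.iInter_of_isOpen fun n =>
      ((hc n).preimage_isClosed_of_isClosed (hC n) hU.isClosed_compl).isOpen_compl

/-- A sequence can be built by successive choices, if the `n`-th condition depends only on the
first `n` values. -/
theorem exists_seq_of_extension {D : Type*} [Nonempty D] (P : ℕ → (ℕ → D) → Prop)
    (hloc : ∀ n s t, (∀ i < n, s i = t i) → P n s → P n t) (hzero : ∀ s, P 0 s)
    (hstep : ∀ n s, P n s → ∃ d, P (n + 1) (Function.update s n d)) : ∃ s, ∀ n, P n s := by
  choose! g hg using hstep
  obtain ⟨d₀⟩ := ‹Nonempty D›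
  let st : ℕ → ℕ → D := fun n =>
    Nat.rec (fun _ => d₀) (fun n s => Function.update s n (g n s)) n
  have hst : ∀ n, P n (st n) := fun n => by
    induction n with
    | zero => exact hzero _
    | succ n ih => exact hg n _ ih
  have hstab : ∀ n i, i < n → st n i = st (i + 1) i := fun n i hi => by
    induction n, hi using Nat.le_induction with
    | base => rfl
    | succ n hn ih =>
      rw [← ih]
      exact Function.update_of_ne (Nat.ne_of_lt hn) _ _
  exact ⟨fun n => st (n + 1) n, fun n => hloc n _ _ (hstab n) (hst n)⟩

/-- The points of `⋃ α, ⋂ n, F (α|n)` that are witnessed by some `α` extending `σ`. -/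
def souslinPiece {Z : Type*} (F : List ℕ → Set Z) (σ : List ℕ) : Set Z :=
  {z | ∃ α : ℕ → ℕ, (∀ n, z ∈ F ((List.range n).map α)) ∧ (List.range σ.length).map α = σ}

theorem souslinPiece_subset {Z : Type*} (F : List ℕ → Set Z) (σ : List ℕ) :
    souslinPiece F σ ⊆ F σ := fun _ ⟨_, hz, hσ⟩ => hσ ▸ hz σ.length

theorem souslinPiece_subset_iUnion {Z : Type*} (F : List ℕ → Set Z) (σ : List ℕ) :
    souslinPiece F σ ⊆ ⋃ k, souslinPiece F (σ ++ [k]) := fun _ ⟨α, hz, hσ⟩ =>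
  mem_iUnion.2 ⟨α σ.length, α, hz, by
    rw [List.length_append, List.length_singleton, List.range_succ, List.map_append, hσ,
      List.map_singleton]⟩

theorem mem_souslinPiece_nil {Z : Type*} {F : List ℕ → Set Z} {z : Z}
    (hz : z ∈ ⋃ α : ℕ → ℕ, ⋂ n : ℕ, F ((List.range n).map α)) : z ∈ souslinPiece F [] := by
  obtain ⟨α, hα⟩ := mem_iUnion.1 hz
  exact ⟨α, mem_iInter.1 hα, rfl⟩

/-- A node of the tree of irreducible points built in the proof of the Jayne–Rogers theorem. -/
structure IrredNode (X Y : Type*) where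
  /-- the irreducible point -/
  pt : X
  /-- the set relative to which the point is irreducible -/
  carrier : Set X
  /-- the neighbourhood of the image of the point -/
  nhd : Set Y
  /-- the index of the Souslin piece containing the carrier -/
  idx : List ℕ

/-- The condition on the `N`-th node; the parent of the node `M + 1` is `(Nat.unpair M).1`. -/
structure IrredNode.Good {Z Y : Type*} [MetricSpace Z] [TopologicalSpace Y] {X : Set Z}
    (f : X → Y) (F : List ℕ → Set Z) (s : ℕ → IrredNode X Y) (N : ℕ) : Prop where
  isOpen_nhd : IsOpen (s N).nhd
  map_mem_nhd : f (s N).pt ∈ (s N).nhd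
  pt_mem : (s N).pt ∈ closure (s N).carrier
  carrier_subset : (s N).carrier ⊆ Subtype.val ⁻¹' souslinPiece F (s N).idx
  idx_zero : N = 0 → (s N).idx = []
  succ : ∀ M, N = M + 1 →
    (s N).carrier ⊆ (s M.unpair.1).carrier ∧
    (s N).carrier ⊆ Metric.closedBall (s M.unpair.1).pt ((1 / 2) ^ M) ∧
    (∃ k, (s N).idx = (s M.unpair.1).idx ++ [k]) ∧
    ∀ j ≤ M, closure (s N).carrier ⊆ f ⁻¹' (closure (s j).nhd)ᶜ

theorem IrredNode.Good.congr {Z Y : Type*} [MetricSpace Z] [TopologicalSpace Y] {X : Set Z}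
    {f : X → Y} {F : List ℕ → Set Z} {s t : ℕ → IrredNode X Y} {N : ℕ}
    (hs : IrredNode.Good f F s N) (h : ∀ i ≤ N, s i = t i) : IrredNode.Good f F t N := by
  obtain ⟨h1, h2, h3, h4, h5, h6⟩ := hs
  rw [h N le_rfl] at h1 h2 h3 h4 h5
  refine ⟨h1, h2, h3, h4, h5, ?_⟩
  rintro M rfl
  have := h6 M rfl
  rw [h _ le_rfl, h _ ((Nat.unpair_left_le M).trans M.le_succ)] at this
  refine ⟨this.1, this.2.1, this.2.2.1, fun j hj => ?_⟩
  rw [← h j (hj.trans M.le_succ)]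
  exact this.2.2.2 j hj

theorem exists_irredNode_tree {Z Y : Type*} [MetricSpace Z] [TopologicalSpace Y]
    [RegularSpace Y] {X : Set Z} {F : List ℕ → Set Z} {f : X → Y}
    (hX : X ⊆ souslinPiece F []) (hf : Sigma02Measurable f) (hnot : ¬ MemIf f univ) :
    ∃ s : ℕ → IrredNode X Y, ∀ N, IrredNode.Good f F s N := by
  have hne : Nonempty (IrredNode X Y) := by
    obtain ⟨x, -⟩ := exists_irredOutside hnot
    exact ⟨⟨x, ∅, ∅, []⟩⟩
  let P : ℕ → (ℕ → IrredNode X Y) → Prop := fun n s =>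
    (∀ N < n, IrredNode.Good f F s N) ∧
      ∀ N < n, IrredOutside f (s N).pt (s N).carrier (⋃ j < n, (s j).nhd)
  suffices h : ∃ s, ∀ n, P n s by
    obtain ⟨s, hs⟩ := h
    exact ⟨s, fun N => (hs (N + 1)).1 N N.lt_succ_self⟩
  refine exists_seq_of_extension P ?_ ?_ ?_
  · rintro n s t hst ⟨h1, h2⟩
    refine ⟨fun N hN => (h1 N hN).congr fun i hi => hst i (hi.trans_lt hN), fun N hN => ?_⟩
    have hU : (⋃ j < n, (s j).nhd) = ⋃ j < n, (t j).nhd :=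
      iUnion₂_congr fun j hj => by rw [hst j hj]
    rw [← hU, ← hst N hN]
    exact h2 N hN
  · exact fun s => ⟨fun N hN => absurd hN N.not_lt_zero, fun N hN => absurd hN N.not_lt_zero⟩
  · rintro n s ⟨h1, h2⟩
    let A : Set Y := ⋃ j < n, (s j).nhd
    -- The set `S` in which the new node is to be found.
    obtain ⟨S, σ, hS, hSA, hSσ, hσ, hSM⟩ : ∃ (S : Set X) (σ : List ℕ), ¬ MemIf f S ∧
        S ⊆ f ⁻¹' (closure A)ᶜ ∧ S ⊆ Subtype.val ⁻¹' souslinPiece F σ ∧ (n = 0 → σ = []) ∧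
        ∀ M, n = M + 1 → S ⊆ (s M.unpair.1).carrier ∧
          S ⊆ Metric.closedBall (s M.unpair.1).pt ((1 / 2) ^ M) ∧
          ∃ k, σ = (s M.unpair.1).idx ++ [k] := by
      rcases n with _ | M
      · exact ⟨univ, [], hnot, by simp [A], fun x _ => hX x.2, fun _ => rfl, by simp⟩
      · have hp : M.unpair.1 < M + 1 := Nat.lt_succ_of_le (Nat.unpair_left_le M)
        set p := s M.unpair.1
        have hirr := h2 _ hp (Metric.ball p.pt ((1 / 2) ^ M)) Metric.isOpen_ball
          (Metric.mem_ball_self (by positivity))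
        have : ∃ k, ¬ MemIf f (Af f A ∩ p.carrier ∩ Metric.ball p.pt ((1 / 2) ^ M) ∩
            Subtype.val ⁻¹' souslinPiece F (p.idx ++ [k])) := by
          by_contra! h
          refine hirr ((MemIf.iUnion h).mono ?_)
          rw [← inter_iUnion, ← preimage_iUnion]
          exact subset_inter Subset.rfl fun x hx =>
            souslinPiece_subset_iUnion F _ ((h1 _ hp).carrier_subset hx.1.2)
        obtain ⟨k, hk⟩ := this
        refine ⟨_, p.idx ++ [k], hk, fun x hx => hx.1.1.1, fun x hx => hx.2, by simp, ?_⟩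
        rintro M' hM
        obtain rfl : M = M' := by omega
        exact ⟨fun x hx => hx.1.1.2, fun x hx => Metric.ball_subset_closedBall hx.1.2, k, rfl⟩
    obtain ⟨x, T, U, hTS, hTA, hxT, hU, hxU, hUA, hirr, hold⟩ :=
      hf.exists_irredOutside (Finset.range n) (x := fun i => (s i).pt)
        (T := fun i => (s i).carrier) (A := A) (fun i hi => h2 i (Finset.mem_range.1 hi)) hS
        isClosed_closure.isOpen_compl hSA
    refine ⟨⟨x, T, U, σ⟩, ?_⟩
    set t := Function.update s n ⟨x, T, U, σ⟩
    have htn : t n = ⟨x, T, U, σ⟩ := Function.update_self _ _ _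
    have hts : ∀ i < n, t i = s i := fun i hi => Function.update_of_ne (Nat.ne_of_lt hi) _ _
    have htU : (⋃ j < n + 1, (t j).nhd) = A ∪ U := by
      rw [biUnion_lt_succ (fun j => (t j).nhd), htn]
      exact congrArg (· ∪ U) (iUnion₂_congr fun j hj => by rw [hts j hj])
    refine ⟨fun N hN => ?_, fun N hN => ?_⟩
    · rcases Nat.lt_succ_iff_lt_or_eq.1 hN with hN | rfl
      · exact (h1 N hN).congr fun i hi => (hts i (hi.trans_lt hN)).symm
      · refine ⟨by rwa [htn], by rwa [htn], by rwa [htn], ?_, by rwa [htn], ?_⟩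
        · rw [htn]
          exact hTS.trans hSσ
        · rintro M rfl
          obtain ⟨hM1, hM2, hM3⟩ := hSM M rfl
          rw [htn, hts _ (Nat.lt_succ_of_le (Nat.unpair_left_le M))]
          refine ⟨hTS.trans hM1, hTS.trans hM2, hM3, fun j hj => ?_⟩
          rw [hts j (Nat.lt_succ_of_le hj)]
          exact hTA.trans (preimage_mono (compl_subset_compl.2 (closure_mono
            (subset_biUnion_of_mem (u := fun j => (s j).nhd) (Nat.lt_succ_of_le hj)))))
    · rw [htU]
      rcases Nat.lt_succ_iff_lt_or_eq.1 hN with hN | rfl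
      · rw [hts N hN]
        exact hold N (Finset.mem_range.2 hN)
      · rw [htn]
        refine fun V hV hxV hm => hirr V hV hxV (hm.mono ?_)
        rintro y ⟨⟨hyU, hyT⟩, hyV⟩
        refine ⟨⟨?_, hyT⟩, hyV⟩
        rw [Af, closure_union, compl_union]
        exact ⟨hTA (subset_closure hyT), hyU⟩

/-- A tree of irreducible nodes yields an open set whose preimage is not a Gδ set. -/
theorem not_isGδ_preimage_iUnion_nhd {Z Y : Type*} [MetricSpace Z] [CompleteSpace Z]
    [TopologicalSpace Y] {X : Set Z} {F : List ℕ → Set Z} (hF : ∀ s, IsClosed (F s))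
    (hX : (⋃ α : ℕ → ℕ, ⋂ n : ℕ, F ((List.range n).map α)) ⊆ X) {f : X → Y}
    {s : ℕ → IrredNode X Y} (hs : ∀ N, IrredNode.Good f F s N) :
    ¬ IsGδ (f ⁻¹' ⋃ N, (s N).nhd) := by
  intro hG
  obtain ⟨G, hGo, hG⟩ := isGδ_iff_eq_iInter_nat.1 hG
  have hptG : ∀ N k, (s N).pt ∈ G k := fun N k =>
    mem_iInter.1 (hG.subset (mem_iUnion.2 ⟨N, (hs N).map_mem_nhd⟩)) k
  have hchild : ∀ N k, ∃ M, M.unpair.1 = N ∧ N ≤ M ∧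
      Metric.closedBall (s N).pt ((1 / 2) ^ M) ⊆ G k := by
    intro N k
    obtain ⟨ε, hε, hball⟩ := Metric.isOpen_iff.1 (hGo k) _ (hptG N k)
    obtain ⟨m, hm⟩ := exists_pow_lt_of_lt_one hε (by norm_num : (1 / 2 : ℝ) < 1)
    have hle : (1 / 2 : ℝ) ^ Nat.pair N m ≤ (1 / 2) ^ m :=
      pow_le_pow_of_le_one (by norm_num) (by norm_num) (Nat.right_le_pair N m)
    exact ⟨Nat.pair N m, by simp, Nat.left_le_pair N m,
      (Metric.closedBall_subset_ball (hle.trans_lt hm)).trans hball⟩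
  choose c hc hcle hcG using hchild
  let b : ℕ → ℕ := fun k => Nat.rec 0 (fun k N => c N k + 1) k
  have hb : ∀ k, b (k + 1) = c (b k) k + 1 := fun _ => rfl
  have hbk : ∀ k, k ≤ b k := fun k => by
    induction k with
    | zero => exact Nat.zero_le _
    | succ k ih => rw [hb]; exact Nat.succ_le_succ (ih.trans (hcle _ _))
  have hsucc := fun k => (hs (b (k + 1))).succ (c (b k) k) (hb k)
  simp only [hc] at hsucc
  choose hcarr hdist hidx havoid using hsucc
  choose β hβ using hidx
  have hanti : Antitone fun k => (s (b k)).carrier := antitone_nat_of_succ_le hcarr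
  have hpt : ∀ {k m}, k ≤ m → (s (b m)).pt ∈ closure (s (b k)).carrier := fun h =>
    closure_mono (hanti h) (hs _).pt_mem
  have hσ : ∀ k, (s (b k)).idx = (List.range k).map β := fun k => by
    induction k with
    | zero => exact (hs 0).idx_zero rfl
    | succ k ih => rw [hβ, ih, List.range_succ, List.map_append, List.map_singleton]
  have hcball : ∀ k, closure (s (b (k + 1))).carrier ⊆
      Metric.closedBall (s (b k)).pt ((1 / 2) ^ c (b k) k) := fun k =>
    closure_minimal (hdist k) Metric.isClosed_closedBall
  have hcauchy : CauchySeq fun k => ((s (b k)).pt : Z) := by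
    refine cauchySeq_of_le_geometric (1 / 2) 1 (by norm_num) fun k => ?_
    have h1 : dist (s (b (k + 1))).pt (s (b k)).pt ≤ (1 / 2) ^ c (b k) k := hcball k (hs _).pt_mem
    rw [one_mul, dist_comm]
    exact h1.trans
      (pow_le_pow_of_le_one (by norm_num) (by norm_num) ((hbk k).trans (hcle _ _)))
  obtain ⟨z, hz⟩ := cauchySeq_tendsto_of_complete hcauchy
  have hzX : z ∈ X := by
    refine hX (mem_iUnion.2 ⟨β, mem_iInter.2 fun k => ?_⟩)
    refine (hF _).mem_of_tendsto hz (Filter.eventually_atTop.2 ⟨k, fun m hm => ?_⟩)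
    have hsub : closure (s (b k)).carrier ⊆ Subtype.val ⁻¹' F ((List.range k).map β) :=
      closure_minimal (((hs _).carrier_subset).trans
        (preimage_mono (hσ k ▸ souslinPiece_subset F _)))
        ((hF _).preimage continuous_subtype_val)
    exact hsub (hpt hm)
  have hzt : Filter.Tendsto (fun k => (s (b k)).pt) Filter.atTop (𝓝 ⟨z, hzX⟩) :=
    tendsto_subtype_rng.2 hz
  have hzc : ∀ k, (⟨z, hzX⟩ : X) ∈ closure (s (b k)).carrier := fun k =>
    isClosed_closure.mem_of_tendsto hzt (Filter.eventually_atTop.2 ⟨k, fun _ hm => hpt hm⟩)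
  have hzU : (⟨z, hzX⟩ : X) ∈ f ⁻¹' ⋃ N, (s N).nhd := by
    rw [hG]
    exact mem_iInter.2 fun k => hcG _ _ (hcball k (hzc (k + 1)))
  obtain ⟨j, hj⟩ := mem_iUnion.1 hzU
  exact havoid j j ((hbk j).trans (hcle _ _)) (hzc (j + 1)) (subset_closure hj)

/-- Jayne–Rogers theorem with regular codomain: for an absolute Souslin-F set X
(realized as a Souslin-F subset of a complete metric space Z) and a regular
topological space Y, a map f : X → Y is Δ⁰₂-measurable iff piecewise continuous. -/
theorem statement1 {Z Y : Type*} [MetricSpace Z] [CompleteSpace Z]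
    [TopologicalSpace Y] [RegularSpace Y]
    (X : Set Z) (hX : SouslinF X) (f : X → Y) :
    Delta02Measurable f ↔ PiecewiseContinuous f := by
  refine ⟨fun hf => ?_, PiecewiseContinuous.delta02Measurable⟩
  by_cases hmem : MemIf f univ
  · obtain ⟨C, hC, hCu, hc⟩ := memIf_iff.1 hmem
    exact ⟨C, hC, univ_subset_iff.1 hCu, hc⟩
  · obtain ⟨F, hF, hXF⟩ := hX
    obtain ⟨s, hs⟩ := exists_irredNode_tree (F := F)
      (fun z hz => mem_souslinPiece_nil (hXF ▸ hz)) (fun U hU => (hf U hU).1) hmem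
    exact absurd (hf _ (isOpen_iUnion fun N => (hs N).isOpen_nhd)).2
      (not_isGδ_preimage_iUnion_nhd hF hXF.ge hs)
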